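/- If λ is a singular cardinal, then a family of topological spaces is productively [λ,λ]-compact if and only if it is either productively [cf λ, cf λ]-compact or productively [λ⁺,λ⁺]-compact. -/

import Mathlib

open Cardinal

universe u

/-- A topological space `X` is `[μ, λ]`-compact iff every open cover of `X`
by at most `λ` many sets has a subcover by fewer than `μ` many sets. -/
def IsMuLamCompact (X : Type u) [TopologicalSpace X]
    (mu lam : Cardinal.{u}) : Prop :=
  ∀ U : Set (Set X), (∀ s ∈ U, IsOpen s) → ⋃₀ U = Set.univ → #U ≤ lam →
    ∃ V ⊆ U, #V < mu ∧ ⋃₀ V = Set.univ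

/-- A family `𝓕` of topological spaces is productively `[μ, λ]`-compact iff
every (Tychonoff) product of members of the family (with repetitions allowed)
is `[μ, λ]`-compact. -/
def IsProductivelyMuLamCompact {ι : Type u} (𝓕 : ι → Type u)
    [∀ i, TopologicalSpace (𝓕 i)] (mu lam : Cardinal.{u}) : Prop :=
  ∀ (σ : Type u) (g : σ → ι), IsMuLamCompact (∀ s, 𝓕 (g s)) mu lam

/-- `D` is `(μ, #A)`-regular. -/
def RegU {I : Type u} (D : Ultrafilter I) (mu : Cardinal.{u}) (A : Type u) : Prop :=
  ∃ f : I → Set A, (∀ i, #(f i) < mu) ∧ ∀ a, ∀ᶠ i in (D : Filter I), a ∈ f i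

def DComp {I : Type u} (D : Ultrafilter I) (X : Type u) [TopologicalSpace X] : Prop :=
  ∀ x : I → X, ∃ y, Filter.Tendsto x D (nhds y)

theorem RegU.of_le {I : Type u} {D : Ultrafilter I} {mu : Cardinal.{u}} {A B : Type u}
    (h : RegU D mu A) (hBA : #B ≤ #A) : RegU D mu B := by
  obtain ⟨f, hf, hf'⟩ := h
  obtain ⟨e⟩ := hBA
  refine ⟨fun i => e ⁻¹' f i, fun i => ?_, fun b => hf' (e b)⟩
  exact (mk_preimage_of_injective _ _ e.injective).trans_lt (hf i)

theorem DComp.pi {I : Type u} {D : Ultrafilter I} {σ : Type u} {X : σ → Type u}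
    [∀ s, TopologicalSpace (X s)] (h : ∀ s, DComp D (X s)) : DComp D (∀ s, X s) := by
  intro x
  choose y hy using fun s => h s (fun i => x i s)
  exact ⟨y, tendsto_pi_nhds.2 hy⟩

theorem DComp.compact {I : Type u} {D : Ultrafilter I} {X : Type u} [TopologicalSpace X]
    (h : DComp D X) {mu lam : Cardinal.{u}} {A : Type u} (hA : #A = lam) (hr : RegU D mu A) :
    IsMuLamCompact X mu lam := by
  intro U hU hcov hcard
  obtain ⟨f, hf, hf'⟩ := hr.of_le (B := U) (by rw [hA]; exact hcard)
  by_contra! hcon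
  have key : ∀ i, ∃ x : X, ∀ u ∈ f i, x ∉ u.1 := by
    intro i
    have h1 := hcon (Subtype.val '' f i) (by rintro _ ⟨u, _, rfl⟩; exact u.2)
      (mk_image_le.trans_lt (hf i))
    rw [Set.ne_univ_iff_exists_notMem] at h1
    obtain ⟨x, hx⟩ := h1
    refine ⟨x, fun u hu hxu => hx ⟨u.1, ⟨u, hu, rfl⟩, hxu⟩⟩
  choose x hx using key
  obtain ⟨y, hy⟩ := h x
  have : y ∈ ⋃₀ U := by rw [hcov]; trivial
  obtain ⟨u, hu, hyu⟩ := this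
  have h1 := hy.eventually ((hU u hu).mem_nhds hyu)
  obtain ⟨i, hi1, hi2⟩ := (h1.and (hf' ⟨u, hu⟩)).exists
  exact hx i _ hi2 hi1

theorem closed_version {X : Type u} [TopologicalSpace X] {mu lam : Cardinal.{u}}
    (h : IsMuLamCompact X mu lam) {A : Type u} (hA : #A ≤ lam) (C : A → Set X)
    (hC : ∀ a, IsClosed (C a)) (hfip : ∀ S : Set A, #S < mu → (⋂ a ∈ S, C a).Nonempty) :
    (⋂ a, C a).Nonempty := by
  by_contra hcon
  rw [Set.not_nonempty_iff_eq_empty] at hcon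
  obtain ⟨V, hV, hVc, hVu⟩ := h (Set.range fun a => (C a)ᶜ)
    (by rintro _ ⟨a, rfl⟩; exact (hC a).isOpen_compl)
    (by
      rw [Set.sUnion_range, ← Set.compl_iInter, hcon, Set.compl_empty])
    (mk_range_le.trans hA)
  choose g hg using hV
  obtain ⟨x, hx⟩ := hfip (Set.range fun v : V => g v.2) (mk_range_le.trans_lt hVc)
  have : x ∈ ⋃₀ V := by rw [hVu]; trivial
  obtain ⟨v, hv, hxv⟩ := this
  have h2 : x ∈ C (g hv) := by
    simp only [Set.mem_iInter] at hx
    exact hx _ ⟨⟨v, hv⟩, rfl⟩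
  rw [← hg hv] at hxv
  exact hxv h2

theorem pc_of_reg {ι : Type u} (𝓕 : ι → Type u) [∀ i, TopologicalSpace (𝓕 i)]
    {mu lam : Cardinal.{u}} {A : Type u} (hA : #A = lam) {I : Type u} {D : Ultrafilter I}
    (hr : RegU D mu A) (hc : ∀ i, DComp D (𝓕 i)) : IsProductivelyMuLamCompact 𝓕 mu lam :=
  fun _ g => (DComp.pi fun s => hc (g s)).compact hA hr

theorem reg_of_pc {ι : Type u} (𝓕 : ι → Type u) [∀ i, TopologicalSpace (𝓕 i)]
    {mu lam : Cardinal.{u}} (hmu : ℵ₀ ≤ mu) {A : Type u} [Infinite A] (hA : #A = lam)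
    (h : IsProductivelyMuLamCompact 𝓕 mu lam) :
    ∃ (I : Type u) (D : Ultrafilter I), RegU D mu A ∧ ∀ i, DComp D (𝓕 i) := by
  classical
  let I := {S : Set A // #S < mu}
  by_contra! hcon
  let TT := {D : Ultrafilter I // RegU D mu A}
  have h1 : ∀ D : TT, ∃ i, ∃ x : I → 𝓕 i, ∀ y, ¬ Filter.Tendsto x D.1 (nhds y) := by
    intro D
    obtain ⟨i, hi⟩ := hcon I D.1 D.2
    rw [DComp] at hi
    push Not at hi
    exact ⟨i, hi⟩
  choose g x hx using h1
  have hX := h TT g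
  let z : I → ∀ s, 𝓕 (g s) := fun i s => x s i
  obtain ⟨y, hy⟩ := closed_version hX (A := Finset A) (by rw [mk_finset_of_infinite, hA])
    (fun s => closure (z '' {i | (s : Set A) ⊆ i.1})) (fun _ => isClosed_closure) (by
      intro S hS
      have hlt : #(⋃ s : S, ((s.1 : Finset A) : Set A)) < mu := by
        rcases lt_or_ge (#S) ℵ₀ with hfin | hinf
        · have : Finite S := lt_aleph0_iff_finite.1 hfin
          refine lt_of_lt_of_le ?_ hmu
          rw [lt_aleph0_iff_finite]
          exact (Set.finite_iUnion fun s => s.1.finite_toSet)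
        · refine lt_of_le_of_lt (mk_iUnion_le _) ?_
          refine lt_of_le_of_lt (mul_le_mul_right (ciSup_le' (a := ℵ₀) fun s => ?_) _) ?_
          · exact (lt_aleph0_iff_finite.2 s.1.finite_toSet).le
          · rwa [mul_aleph0_eq hinf]
      refine ⟨z ⟨_, hlt⟩, ?_⟩
      simp only [Set.mem_iInter]
      intro s hs
      apply subset_closure
      exact ⟨_, Set.subset_iUnion (fun s : S => ((s.1 : Finset A) : Set A)) ⟨s, hs⟩, rfl⟩)
  simp only [Set.mem_iInter] at hy
  let G : Filter I := Filter.comap z (nhds y) ⊓ ⨅ a : A, Filter.principal {i | a ∈ i.1}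
  have hG : G.NeBot := by
    have hbasis : (⨅ a : A, Filter.principal {i : I | a ∈ i.1}).HasBasis
        (fun s : Set A => s.Finite) (fun s => ⋂ a ∈ s, {i : I | a ∈ i.1}) :=
      Filter.hasBasis_iInf_principal_finite _
    rw [((nhds y).basis_sets.comap z).inf_basis_neBot_iff hbasis]
    intro N hN s hs
    obtain ⟨_, hw1, i, hi, rfl⟩ := mem_closure_iff_nhds.1 (hy hs.toFinset) N hN
    refine ⟨i, hw1, ?_⟩
    simp only [Set.mem_iInter]
    intro a ha
    exact hi (by simpa using ha)
  let D := Ultrafilter.of G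
  have hD : (D : Filter I) ≤ G := Ultrafilter.of_le G
  have hreg : RegU D mu A := by
    refine ⟨fun i => i.1, fun i => i.2, fun a => ?_⟩
    apply hD
    apply Filter.mem_inf_of_right
    exact Filter.mem_iInf_of_mem a (Filter.mem_principal_self _)
  apply hx ⟨D, hreg⟩ (y ⟨D, hreg⟩)
  have ht : Filter.Tendsto z D (nhds y) :=
    Filter.tendsto_iff_comap.2 (hD.trans inf_le_left)
  exact (tendsto_pi_nhds.1 ht) ⟨D, hreg⟩

/-- Least strict upper bound of a set of ordinals. -/
noncomputable def lsup (s : Set Ordinal.{u}) : Ordinal.{u} := sInf {a | ∀ x ∈ s, x < a}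

theorem lsup_le {s : Set Ordinal.{u}} {a : Ordinal.{u}} (h : ∀ x ∈ s, x < a) : lsup s ≤ a :=
  csInf_le' h

theorem lt_lsup {s : Set Ordinal.{u}} {b : Ordinal.{u}} (hb : ∀ x ∈ s, x < b)
    {x : Ordinal.{u}} (hx : x ∈ s) : x < lsup s :=
  csInf_mem (s := {a | ∀ x ∈ s, x < a}) ⟨b, hb⟩ x hx

theorem exists_of_lt_lsup {s : Set Ordinal.{u}} {a : Ordinal.{u}} (h : a < lsup s) :
    ∃ x ∈ s, a ≤ x := by
  by_contra! hc
  exact (lsup_le hc).not_gt h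

theorem lsup_lt {c : Cardinal.{u}} (hc : c.IsRegular) {s : Set Ordinal.{u}}
    (hs : #s < lift.{u + 1} c) (h : ∀ x ∈ s, x < c.ord) : lsup s < c.ord := by
  have h1 : sSup ((· + 1) '' s) < c.ord := by
    apply Ordinal.sSup_add_one_lt_of_lt_cof _ h
    rwa [← Ordinal.lift_cof, hc.cof_ord]
  refine lt_of_le_of_lt (lsup_le fun x hx => ?_) h1
  refine lt_of_lt_of_le (lt_add_one x) (le_csSup ⟨c.ord, ?_⟩ ⟨x, hx, rfl⟩)
  rintro _ ⟨y, hy, rfl⟩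
  exact Order.add_one_le_of_lt (h y hy)

theorem mk_image_Iio_le (f : Ordinal.{u} → Ordinal.{u}) (o : Ordinal.{u}) :
    #(f '' Set.Iio o) ≤ lift.{u + 1} o.card :=
  mk_image_le.trans (mk_Iio_ordinal o).le

theorem reg_add_one_lt {c : Cardinal.{u}} (hc : ℵ₀ ≤ c) {i : Ordinal.{u}} (h : i < c.ord) :
    i + 1 < c.ord := by
  have := (isSuccLimit_ord hc).succ_lt h
  simpa using this

theorem exists_seq {c : Cardinal.{u}} (hc : c.IsRegular) (g : Ordinal.{u} → Ordinal.{u})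
    (hg : ∀ i < c.ord, g i < c.ord) :
    ∃ z : Ordinal.{u} → Ordinal.{u}, (∀ i < c.ord, z i < c.ord) ∧
      (∀ i < c.ord, ∀ j < i, z j < z i) ∧
      ∀ i < c.ord, (∀ j < i, j + 1 < i) →
        (∀ y < z i, ∃ j < i, y < z j) ∧ ∀ y < z i, g y < z i := by
  let G : Ordinal.{u} → Ordinal.{u} := fun x => max x (lsup (g '' Set.Iic x))
  have himg : ∀ x < c.ord, ∀ y ∈ g '' Set.Iic x, y < c.ord := by
    rintro x hx _ ⟨y, hy, rfl⟩
    exact hg y (lt_of_le_of_lt hy hx)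
  have hG : ∀ x < c.ord, G x < c.ord := by
    intro x hx
    refine max_lt hx (lsup_lt hc ?_ (himg x hx))
    have : Set.Iic x = Set.Iio (x + 1) := by ext; simp
    rw [this]
    refine (mk_image_Iio_le _ _).trans_lt ?_
    rw [lift_lt]
    exact lt_ord.1 (reg_add_one_lt hc.1 hx)
  have hwf : ∃ z : Ordinal.{u} → Ordinal.{u}, ∀ i, z i = lsup {y | ∃ j, j < i ∧ y = G (z j)} := by
    let F : (i : Ordinal.{u}) → ((j : Ordinal.{u}) → j < i → Ordinal.{u}) → Ordinal.{u} :=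
      fun i f => lsup {y | ∃ j, ∃ h : j < i, y = G (f j h)}
    refine ⟨Ordinal.lt_wf.fix F, fun i => ?_⟩
    rw [WellFounded.fix_eq]
    simp only [F, exists_prop]
  obtain ⟨z, hz⟩ := hwf
  have hz1 : ∀ i < c.ord, z i < c.ord := by
    intro i
    induction i using WellFoundedLT.induction with
    | ind i ih =>
      intro hi
      rw [hz]
      apply lsup_lt hc
      · have : {y | ∃ j, j < i ∧ y = G (z j)} = (fun j => G (z j)) '' Set.Iio i := by
          ext y; simp [eq_comm]
        rw [this]
        refine (mk_image_Iio_le _ _).trans_lt ?_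
        rw [lift_lt]
        exact lt_ord.1 hi
      · rintro _ ⟨j, hj, rfl⟩
        exact hG _ (ih j hj (hj.trans hi))
  have hz2 : ∀ i < c.ord, ∀ j < i, G (z j) < z i := by
    intro i hi j hj
    rw [hz i]
    refine lt_lsup (b := c.ord) ?_ ⟨j, hj, rfl⟩
    rintro _ ⟨j, hj, rfl⟩
    exact hG _ (hz1 j (hj.trans hi))
  have hz3 : ∀ i < c.ord, (∀ j < i, j + 1 < i) → ∀ y < z i, ∃ j < i, y < z j := by
    intro i hi hlim y hy
    rw [hz i] at hy
    obtain ⟨_, ⟨j, hj, rfl⟩, hyj⟩ := exists_of_lt_lsup hy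
    exact ⟨j + 1, hlim j hj, hyj.trans_lt (hz2 _ ((hlim j hj).trans hi) _ (lt_add_one j))⟩
  refine ⟨z, hz1, fun i hi j hj => (le_max_left _ _).trans_lt (hz2 i hi j hj), ?_⟩
  intro i hi hlim
  refine ⟨hz3 i hi hlim, fun y hy => ?_⟩
  obtain ⟨j, hj, hyj⟩ := hz3 i hi hlim y hy
  refine lt_trans ?_ (hz2 i hi j hj)
  exact lt_of_lt_of_le (lt_lsup (himg _ (hz1 j (hj.trans hi))) ⟨y, hyj.le, rfl⟩) (le_max_right _ _)

/-- Any club (given by closure points) in a regular uncountable cardinal has full size. -/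
theorem mk_closed {c : Cardinal.{u}} (hc : c.IsRegular) (hc' : ℵ₀ < c)
    (g : Ordinal.{u} → Ordinal.{u}) (hg : ∀ i < c.ord, g i < c.ord) :
    lift.{u + 1} c ≤ #{i : Ordinal.{u} | i < c.ord ∧ ∀ j < i, g j < i} := by
  by_contra! hlt
  have hx := lsup_lt hc hlt (fun x hx => hx.1)
  set x := lsup {i : Ordinal.{u} | i < c.ord ∧ ∀ j < i, g j < i} with hxdef
  obtain ⟨z, hz1, hz2, hz3⟩ := exists_seq hc (fun i => max x (g i))
    (fun i hi => max_lt hx (hg i hi))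
  have hom : Ordinal.omega0 < c.ord := by
    rw [← ord_aleph0]; exact ord_lt_ord.2 hc'
  have hlim : ∀ j < Ordinal.omega0.{u}, j + 1 < Ordinal.omega0 := by
    intro j hj
    rw [← ord_aleph0] at hj ⊢
    exact reg_add_one_lt le_rfl hj
  obtain ⟨_, h2⟩ := hz3 _ hom hlim
  have hpos : 0 < z Ordinal.omega0 :=
    (zero_le (a := z 0)).trans_lt (hz2 _ hom 0 Ordinal.omega0_pos)
  have hmem : z Ordinal.omega0 ∈ {i : Ordinal.{u} | i < c.ord ∧ ∀ j < i, g j < i} :=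
    ⟨hz1 _ hom, fun j hj => (le_max_right _ _).trans_lt (h2 j hj)⟩
  have h4 := lt_lsup (b := c.ord) (fun x hx => hx.1) hmem
  have h5 : x < z Ordinal.omega0 := (le_max_left _ _).trans_lt (h2 0 hpos)
  exact lt_asymm h4 h5

theorem match_lemma {c : Cardinal.{u}} (hc : c.IsRegular) {δ : Ordinal.{u}}
    (a z : Ordinal.{u} → Ordinal.{u}) (ha : ∀ i < c.ord, a i < δ)
    (ha' : ∀ y < δ, ∃ i < c.ord, y ≤ a i)
    (hz : ∀ i < c.ord, z i < δ) (hz' : ∀ y < δ, ∃ i < c.ord, y ≤ z i)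
    (hmono : ∀ i < c.ord, ∀ j < i, z j < z i)
    (hcont : ∀ i < c.ord, (∀ j < i, j + 1 < i) → ∀ y < z i, ∃ j < i, y < z j) :
    ∃ g : Ordinal.{u} → Ordinal.{u}, (∀ i < c.ord, g i < c.ord) ∧ (∀ i, i + 1 ≤ g i) ∧
      ∀ i < c.ord, (∀ j < i, g j < i) → lsup (a '' Set.Iio i) = z i := by
  have h1 : ∀ j, ∃ i, j < c.ord → i < c.ord ∧ a j ≤ z i := by
    intro j
    by_cases hj : j < c.ord
    · obtain ⟨i, hi⟩ := hz' _ (ha j hj)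
      exact ⟨i, fun _ => hi⟩
    · exact ⟨0, fun h => absurd h hj⟩
  have h2 : ∀ j, ∃ i, j < c.ord → i < c.ord ∧ z j ≤ a i := by
    intro j
    by_cases hj : j < c.ord
    · obtain ⟨i, hi⟩ := ha' _ (hz j hj)
      exact ⟨i, fun _ => hi⟩
    · exact ⟨0, fun h => absurd h hj⟩
  choose g1 hg1 using h1
  choose g2 hg2 using h2
  refine ⟨fun j => max (j + 1) (max (g1 j) (g2 j)), fun i hi => ?_, fun i => le_max_left _ _, ?_⟩
  · exact max_lt (reg_add_one_lt hc.1 hi) (max_lt (hg1 i hi).1 (hg2 i hi).1)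
  intro i hi hcl
  have hb : ∀ y ∈ a '' Set.Iio i, y < z i := by
    rintro _ ⟨j, hj, rfl⟩
    have hj' : j < i := hj
    exact (hg1 j (hj'.trans hi)).2.trans_lt
      (hmono i hi _ (lt_of_le_of_lt ((le_max_left _ _).trans (le_max_right _ _)) (hcl j hj')))
  apply le_antisymm (lsup_le hb)
  by_contra! hlt
  obtain ⟨j, hj, hlj⟩ := hcont i hi
    (fun j hj => lt_of_le_of_lt (le_max_left _ _) (hcl j hj)) _ hlt
  have h3 : g2 j < i := lt_of_le_of_lt ((le_max_right _ _).trans (le_max_right _ _)) (hcl j hj)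
  have h4 : a (g2 j) < lsup (a '' Set.Iio i) := lt_lsup hb ⟨_, h3, rfl⟩
  exact absurd (hlj.trans_le (hg2 j (hj.trans hi)).2) h4.not_gt

open Classical in
/-- A chosen cofinal map from `o` to `δ`, if there is one. -/
noncomputable def cc (o δ : Ordinal.{u}) : Ordinal.{u} → Ordinal.{u} :=
  if h : ∃ a : Ordinal.{u} → Ordinal.{u}, (∀ i < o, a i < δ) ∧ ∀ y < δ, ∃ i < o, y ≤ a i
  then h.choose else fun _ => 0

theorem cc_spec {o δ : Ordinal.{u}}
    (h : ∃ a : Ordinal.{u} → Ordinal.{u}, (∀ i < o, a i < δ) ∧ ∀ y < δ, ∃ i < o, y ≤ a i) :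
    (∀ i < o, cc o δ i < δ) ∧ ∀ y < δ, ∃ i < o, y ≤ cc o δ i := by
  rw [cc, dif_pos h]
  exact h.choose_spec

/-- The club of `δ` obtained from the chosen cofinal map. -/
noncomputable def clubOf (o δ : Ordinal.{u}) : Set Ordinal.{u} :=
  (fun i => lsup (cc o δ '' Set.Iio i)) '' Set.Iio o

theorem mk_clubOf (c : Cardinal.{u}) (δ : Ordinal.{u}) : #(clubOf c.ord δ) ≤ lift.{u + 1} c := by
  have := mk_image_Iio_le (fun i => lsup (cc c.ord δ '' Set.Iio i)) c.ord
  rw [card_ord] at this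
  exact this

theorem clubOf_match {c : Cardinal.{u}} (hc : c.IsRegular) {δ : Ordinal.{u}}
    (z : Ordinal.{u} → Ordinal.{u})
    (hz : ∀ i < c.ord, z i < δ) (hz' : ∀ y < δ, ∃ i < c.ord, y ≤ z i)
    (hmono : ∀ i < c.ord, ∀ j < i, z j < z i)
    (hcont : ∀ i < c.ord, (∀ j < i, j + 1 < i) → ∀ y < z i, ∃ j < i, y < z j) :
    ∃ g : Ordinal.{u} → Ordinal.{u}, (∀ i < c.ord, g i < c.ord) ∧ (∀ i, i + 1 ≤ g i) ∧
      ∀ i < c.ord, (∀ j < i, g j < i) → z i ∈ clubOf c.ord δ := by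
  obtain ⟨h1, h2⟩ := cc_spec ⟨z, hz, hz'⟩
  obtain ⟨g, hg, hg', hg''⟩ := match_lemma hc (cc c.ord δ) z h1 h2 hz hz' hmono hcont
  exact ⟨g, hg, hg', fun i hi hcl => ⟨i, hi, hg'' i hi hcl⟩⟩

/-- Weak club guessing. -/
theorem guess {θ : Cardinal.{u}} (hθ : θ.IsRegular) (hθ' : ℵ₀ < θ) {μ : Cardinal.{u}}
    (hμ : μ = Order.succ (Order.succ θ)) :
    ∃ B : Ordinal.{u} → Set Ordinal.{u}, (∀ t, ∀ i ∈ B t, i < μ.ord) ∧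
      ∀ g : Ordinal.{u} → Ordinal.{u}, (∀ i < μ.ord, g i < μ.ord) →
        ∃ t < μ.ord, lift.{u + 1} θ ≤ #(B t) ∧ ∀ i ∈ B t, ∀ j < i, g j < i := by
  have hθs : ℵ₀ ≤ Order.succ θ := hθ.1.trans (Order.le_succ θ)
  have hμr : μ.IsRegular := hμ ▸ isRegular_succ hθs
  have hsμ : Order.succ θ < μ := hμ ▸ Order.lt_succ _
  have hθμ : θ < μ := (Order.lt_succ θ).trans hsμ
  let C : Ordinal.{u} → Set Ordinal.{u} := fun δ => clubOf θ.ord δ ∩ Set.Iio μ.ord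
  have hC : ∀ δ, #(C δ) ≤ lift.{u + 1} θ := fun δ =>
    (mk_le_mk_of_subset Set.inter_subset_left).trans (mk_clubOf θ δ)
  have factA : ∀ g : Ordinal.{u} → Ordinal.{u}, (∀ i < μ.ord, g i < μ.ord) →
      ∃ δ < μ.ord, lift.{u + 1} θ ≤ #((C δ ∩ {i | ∀ j < i, g j < i} : Set Ordinal.{u})) := by
    intro g hg
    obtain ⟨z, hz1, hz2, hz3⟩ := exists_seq hμr g hg
    have hoo : θ.ord < μ.ord := ord_lt_ord.2 hθμ
    have hb : ∀ y ∈ z '' Set.Iio θ.ord, y < μ.ord := by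
      rintro _ ⟨j, hj, rfl⟩
      exact hz1 j (lt_trans hj hoo)
    refine ⟨lsup (z '' Set.Iio θ.ord), lsup_lt hμr ?_ hb, ?_⟩
    · refine (mk_image_Iio_le _ _).trans_lt ?_
      rw [lift_lt, card_ord]; exact hθμ
    obtain ⟨g', hg1, hg2, hg3⟩ := clubOf_match hθ (δ := lsup (z '' Set.Iio θ.ord)) z
      (fun i hi => lt_lsup hb ⟨i, hi, rfl⟩)
      (fun y hy => by
        obtain ⟨_, ⟨i, hi, rfl⟩, h⟩ := exists_of_lt_lsup hy
        exact ⟨i, hi, h⟩)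
      (fun i hi j hj => hz2 i (hi.trans hoo) j hj)
      (fun i hi hl => (hz3 i (hi.trans hoo) hl).1)
    refine (mk_closed hθ hθ' g' hg1).trans ?_
    refine mk_le_of_injective (f := fun i => ⟨z i.1, ?_⟩) ?_
    · obtain ⟨i, hi, hcl⟩ := i
      refine ⟨⟨hg3 i hi hcl, hz1 i (hi.trans hoo)⟩, ?_⟩
      exact (hz3 i (hi.trans hoo) (fun j hj => (hg2 j).trans_lt (hcl j hj))).2
    · rintro ⟨i, hi, _⟩ ⟨j, hj, _⟩ h
      simp only [Subtype.mk.injEq] at h ⊢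
      rcases lt_trichotomy i j with h1 | h1 | h1
      · exact absurd h (hz2 j (hj.trans hoo) i h1).ne
      · exact h1
      · exact absurd h (hz2 i (hi.trans hoo) j h1).ne'
  by_contra! hcon
  have hN : ∀ g0 : Ordinal.{u} → Ordinal.{u}, ∃ g1 : Ordinal.{u} → Ordinal.{u},
      (∀ i < μ.ord, g1 i < μ.ord) ∧ ∀ t < μ.ord,
        lift.{u + 1} θ ≤ #((C t ∩ {i | ∀ j < i, g0 j < i} : Set Ordinal.{u})) →
        ∃ x ∈ C t ∩ {i | ∀ j < i, g0 j < i}, ∃ j < x, x ≤ g1 j := by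
    intro g0
    exact hcon (fun t => C t ∩ {i | ∀ j < i, g0 j < i}) (fun t i hi => hi.1.2)
  choose N hN1 hN2 using hN
  have hwf : ∃ G : Ordinal.{u} → Ordinal.{u} → Ordinal.{u}, ∀ α x,
      G α x = lsup {y | ∃ β, β < α ∧ y = max (G β x) (N (G β) x)} := by
    let F : (α : Ordinal.{u}) → ((β : Ordinal.{u}) → β < α → Ordinal.{u} → Ordinal.{u}) →
        Ordinal.{u} → Ordinal.{u} :=
      fun α f x => lsup {y | ∃ β, ∃ h : β < α, y = max (f β h x) (N (f β h) x)}
    refine ⟨Ordinal.lt_wf.fix F, fun α x => ?_⟩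
    rw [WellFounded.fix_eq]
    simp only [F, exists_prop]
  obtain ⟨G, hG⟩ := hwf
  have hG1 : ∀ α ≤ (Order.succ θ).ord, ∀ x < μ.ord, G α x < μ.ord := by
    intro α
    induction α using WellFoundedLT.induction with
    | ind α ih =>
      intro hα x hx
      rw [hG]
      apply lsup_lt hμr
      · have : {y | ∃ β, β < α ∧ y = max (G β x) (N (G β) x)} =
            (fun β => max (G β x) (N (G β) x)) '' Set.Iio α := by
          ext y; simp [eq_comm]
        rw [this]
        refine (mk_image_Iio_le _ _).trans_lt ?_
        rw [lift_lt]
        refine lt_of_le_of_lt (Ordinal.card_le_card hα) ?_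
        rwa [card_ord]
      · rintro _ ⟨β, hβ, rfl⟩
        exact max_lt (ih β hβ (hβ.le.trans hα) x hx) (hN1 _ x hx)
  have hG2 : ∀ α ≤ (Order.succ θ).ord, ∀ x < μ.ord, ∀ β < α,
      max (G β x) (N (G β) x) < G α x := by
    intro α hα x hx β hβ
    rw [hG α]
    refine lt_lsup (b := μ.ord) ?_ ⟨β, hβ, rfl⟩
    rintro _ ⟨β, hβ, rfl⟩
    exact max_lt (hG1 β (hβ.le.trans hα) x hx) (hN1 _ x hx)
  obtain ⟨δ, hδ, hδ'⟩ := factA (G (Order.succ θ).ord) (hG1 _ le_rfl)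
  have hx : ∀ α : Set.Iio (Order.succ θ).ord,
      ∃ x ∈ C δ ∩ {i | ∀ j < i, G α.1 j < i}, ∃ j < x, x ≤ N (G α.1) j := by
    intro α
    apply hN2 _ δ hδ
    refine hδ'.trans (mk_le_mk_of_subset ?_)
    rintro i ⟨hi1, hi2⟩
    refine ⟨hi1, fun j hj => ?_⟩
    exact lt_of_le_of_lt (le_max_left _ _) ((hG2 _ le_rfl j (hj.trans hi1.2) α.1 α.2).trans
      (hi2 j hj))
  choose x hx1 hx2 using hx
  have hne : ∀ α β : Set.Iio (Order.succ θ).ord, β < α → x β ≠ x α := by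
    intro α β hβα he
    obtain ⟨j, hj, hj'⟩ := hx2 β
    have hcl := (hx1 α).2 j (he ▸ hj)
    have h3 := hG2 α.1 (le_of_lt α.2) j (hj.trans (hx1 β).1.2) β.1 hβα
    have h4 : N (G β.1) j < x α := (le_max_right _ _).trans_lt (h3.trans hcl)
    exact absurd (hj'.trans_lt h4) (by rw [he]; exact lt_irrefl _)
  have hle : #(Set.Iio (Order.succ θ).ord) ≤ #(C δ) := by
    refine mk_le_of_injective (f := fun α => ⟨x α, (hx1 α).1⟩) ?_
    intro α β h
    simp only [Subtype.mk.injEq] at h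
    rcases lt_trichotomy α β with h1 | h1 | h1
    · exact absurd h (hne β α h1)
    · exact h1
    · exact absurd h.symm (hne α β h1)
  have h5 := hle.trans (hC δ)
  rw [mk_Iio_ordinal, card_ord, lift_le] at h5
  exact (Order.lt_succ θ).not_ge h5

theorem exists_e {lam : Cardinal.{u}} {α : Ordinal.{u}} (hα : α < (Order.succ lam).ord) :
    ∃ e : Ordinal.{u} → Ordinal.{u}, Set.InjOn e (Set.Iio α) ∧ ∀ β < α, e β < lam.ord := by
  have h1 : #(Set.Iio α) ≤ #(Set.Iio lam.ord) := by
    rw [mk_Iio_ordinal, mk_Iio_ordinal, lift_le, card_ord]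
    exact Order.lt_succ_iff.1 (lt_ord.1 hα)
  obtain ⟨f⟩ := h1
  classical
  refine ⟨fun β => if h : β < α then (f ⟨β, h⟩).1 else 0, ?_, ?_⟩
  · intro β hβ γ hγ h
    have hβ' : β < α := hβ
    have hγ' : γ < α := hγ
    simp only [dif_pos hβ', dif_pos hγ'] at h
    have := f.injective (Subtype.ext h)
    exact congrArg Subtype.val this
  · intro β hβ
    simp only [dif_pos hβ]
    exact (f ⟨β, hβ⟩).2

theorem mk_e_lt {e : Ordinal.{u} → Ordinal.{u}} {α : Ordinal.{u}} (he : Set.InjOn e (Set.Iio α))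
    (c : Cardinal.{u}) : #{β : Ordinal.{u} | β < α ∧ e β < c.ord} ≤ lift.{u + 1} c := by
  have h1 : #{β : Ordinal.{u} | β < α ∧ e β < c.ord} ≤ #(Set.Iio c.ord) := by
    refine mk_le_of_injective (f := fun β => ⟨e β.1, β.2.2⟩) ?_
    intro β γ h
    exact Subtype.ext (he β.2.1 γ.2.1 (congrArg Subtype.val h))
  rwa [mk_Iio_ordinal, card_ord] at h1

open Filter in
theorem exists_h {lam : Cardinal.{u}} {K : Type u} [LinearOrder K]
    (l : K → Cardinal.{u}) (hmono : Monotone l) (hl0 : ∀ ξ, ℵ₀ ≤ l ξ) (hl1 : ∀ ξ, l ξ < lam)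
    (hlim : ∀ c < lam, Order.succ c < lam)
    (hl2 : ∀ c < lam, ∃ ξ, c < l ξ) {μ : Cardinal.{u}} (hμ : μ < lam)
    (E : Ordinal.{u} → Set Ordinal.{u}) (hE : ∀ δ, #(E δ) ≤ lift.{u + 1} μ) :
    ∃ h : Ordinal.{u} → K → Ordinal.{u},
      (∀ α < (Order.succ lam).ord, ∀ ξ, h α ξ < lam.ord) ∧
      (∀ β < (Order.succ lam).ord, ∀ α < β, ∀ᶠ ξ in atTop, h α ξ < h β ξ) ∧
      (∀ δ < (Order.succ lam).ord, ∀ᶠ ξ in atTop, ∀ β ∈ E δ, β < δ → h β ξ < h δ ξ) := by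
  have h0 : ∀ α : Ordinal.{u}, ∃ e : Ordinal.{u} → Ordinal.{u}, α < (Order.succ lam).ord →
      Set.InjOn e (Set.Iio α) ∧ ∀ β < α, e β < lam.ord := by
    intro α
    by_cases hα : α < (Order.succ lam).ord
    · obtain ⟨e, he⟩ := exists_e hα
      exact ⟨e, fun _ => he⟩
    · exact ⟨id, fun h => absurd h hα⟩
  choose e he using h0
  let b : Ordinal.{u} → K → Set Ordinal.{u} := fun α ξ =>
    {β | β < α ∧ (e α β < (l ξ).ord ∨ (β ∈ E α ∧ μ ≤ l ξ))}
  have hb : ∀ α < (Order.succ lam).ord, ∀ ξ, #(b α ξ) ≤ lift.{u + 1} (l ξ) := by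
    intro α hα ξ
    have h1 : b α ξ ⊆ {β | β < α ∧ e α β < (l ξ).ord} ∪ {β | β ∈ E α ∧ μ ≤ l ξ} := by
      rintro β ⟨h1, h2 | h2⟩
      · exact Or.inl ⟨h1, h2⟩
      · exact Or.inr h2
    have h3 : #{β | β ∈ E α ∧ μ ≤ l ξ} ≤ lift.{u + 1} (l ξ) := by
      by_cases hh : μ ≤ l ξ
      · exact (mk_le_mk_of_subset fun β hβ => hβ.1).trans ((hE α).trans (lift_le.2 hh))
      · simp [hh]
    refine (mk_le_mk_of_subset h1).trans ((mk_union_le _ _).trans ?_)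
    refine (add_le_add (mk_e_lt (he α hα).1 _) h3).trans ?_
    rw [add_eq_self]
    rw [aleph0_le_lift]
    exact hl0 ξ
  have hwf : ∃ h : Ordinal.{u} → K → Ordinal.{u}, ∀ α ξ,
      h α ξ = lsup {y | ∃ β, β < α ∧ β ∈ b α ξ ∧ y = h β ξ} := by
    let F : (α : Ordinal.{u}) → ((β : Ordinal.{u}) → β < α → K → Ordinal.{u}) →
        K → Ordinal.{u} :=
      fun α f ξ => lsup {y | ∃ β, ∃ h : β < α, β ∈ b α ξ ∧ y = f β h ξ}
    refine ⟨Ordinal.lt_wf.fix F, fun α x => ?_⟩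
    rw [WellFounded.fix_eq]
    simp only [F, exists_prop]
  obtain ⟨h, hh⟩ := hwf
  have hlt : ∀ α < (Order.succ lam).ord, ∀ ξ, h α ξ < (Order.succ (l ξ)).ord := by
    intro α
    induction α using WellFoundedLT.induction with
    | ind α ih =>
      intro hα ξ
      rw [hh]
      apply lsup_lt (isRegular_succ (hl0 ξ))
      · have : {y | ∃ β, β < α ∧ β ∈ b α ξ ∧ y = h β ξ} ⊆ (fun β => h β ξ) '' b α ξ := by
          rintro _ ⟨β, _, hβ, rfl⟩
          exact ⟨β, hβ, rfl⟩
        refine ((mk_le_mk_of_subset this).trans mk_image_le).trans_lt ?_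
        refine (hb α hα ξ).trans_lt ?_
        rw [lift_lt]
        exact Order.lt_succ _
      · rintro _ ⟨β, hβ, _, rfl⟩
        exact ih β hβ (hβ.trans hα) ξ
  have hlt2 : ∀ α < (Order.succ lam).ord, ∀ ξ, ∀ β ∈ b α ξ, h β ξ < h α ξ := by
    intro α hα ξ β hβ
    rw [hh α]
    refine lt_lsup (b := (Order.succ (l ξ)).ord) ?_ ⟨β, hβ.1, hβ, rfl⟩
    rintro _ ⟨β, hβ, _, rfl⟩
    exact hlt β (hβ.trans hα) ξ
  refine ⟨h, fun α hα ξ => (hlt α hα ξ).trans (ord_lt_ord.2 (hlim _ (hl1 ξ))), ?_, ?_⟩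
  · intro β hβ α hα
    obtain ⟨ξ0, h0⟩ := hl2 _ (lt_ord.1 ((he β hβ).2 α hα))
    filter_upwards [eventually_ge_atTop ξ0] with ξ hξ
    exact hlt2 β hβ ξ α ⟨hα, Or.inl (lt_ord.2 (h0.trans_le (hmono hξ)))⟩
  · intro δ hδ
    obtain ⟨ξ0, h0⟩ := hl2 _ hμ
    filter_upwards [eventually_ge_atTop ξ0] with ξ hξ β hβ hβδ
    exact hlt2 δ hδ ξ β ⟨hβδ, Or.inr ⟨hβ, h0.le.trans (hmono hξ)⟩⟩

/-- The least element of `F ∪ {top}` above `x`. -/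
noncomputable def pr (top : Ordinal.{u}) (F : Set Ordinal.{u}) (x : Ordinal.{u}) : Ordinal.{u} :=
  sInf {y | y ∈ insert top F ∧ x ≤ y}

theorem pr_spec {top : Ordinal.{u}} (F : Set Ordinal.{u}) {x : Ordinal.{u}} (hx : x ≤ top) :
    pr top F x ∈ insert top F ∧ x ≤ pr top F x :=
  csInf_mem (s := {y | y ∈ insert top F ∧ x ≤ y}) ⟨top, Set.mem_insert _ _, hx⟩

theorem pr_mono {top : Ordinal.{u}} (F : Set Ordinal.{u}) {x y : Ordinal.{u}} (hxy : x ≤ y)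
    (hy : y ≤ top) : pr top F x ≤ pr top F y :=
  csInf_le' ⟨(pr_spec F hy).1, hxy.trans (pr_spec F hy).2⟩

theorem pr_eq {top : Ordinal.{u}} {F : Set Ordinal.{u}} {x : Ordinal.{u}} (hx : x ∈ F)
    (hx' : x ≤ top) : pr top F x = x :=
  le_antisymm (csInf_le' ⟨Set.mem_insert_of_mem _ hx, le_rfl⟩) (pr_spec F hx').2

open Filter in
theorem stab {lam ν μ : Cardinal.{u}} {K : Type u} [LinearOrder K] [Nonempty K]
    (hν : ℵ₀ ≤ ν) (hK : #K ≤ ν) (hμ : μ = Order.succ (Order.succ (Order.succ ν)))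
    (hμl : μ < lam) (h : Ordinal.{u} → K → Ordinal.{u})
    (ha : ∀ α < (Order.succ lam).ord, ∀ ξ, h α ξ < lam.ord)
    (hb : ∀ β < (Order.succ lam).ord, ∀ α < β, ∀ᶠ ξ in atTop, h α ξ < h β ξ)
    (hc : ∀ δ < (Order.succ lam).ord, ∀ᶠ ξ in atTop, ∀ β ∈ clubOf μ.ord δ, β < δ → h β ξ < h δ ξ)
    (F : Set Ordinal.{u}) (hF : #F ≤ lift.{u + 1} ν) :
    ∃ α₀ < (Order.succ lam).ord, ∀ α, α₀ ≤ α → α < (Order.succ lam).ord →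
      ∀ᶠ ξ in atTop, pr lam.ord F (h α ξ) = pr lam.ord F (h α₀ ξ) := by
  have hθr : (Order.succ ν).IsRegular := isRegular_succ hν
  have hθ0 : ℵ₀ < Order.succ ν := Order.lt_succ_iff.2 hν
  have hμr : μ.IsRegular := hμ ▸ isRegular_succ (hθ0.le.trans (Order.le_succ _))
  have hinf : ℵ₀ ≤ lam := hμr.1.trans hμl.le
  have hΛr : (Order.succ lam).IsRegular := isRegular_succ hinf
  set Λ := (Order.succ lam).ord with hΛ
  have hμΛ : μ < Order.succ lam := hμl.trans (Order.lt_succ _)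
  by_contra! hcon
  have hs : ∀ α, ∃ α', α < Λ → α ≤ α' ∧ α' < Λ ∧
      ∃ᶠ ξ in atTop, pr lam.ord F (h α' ξ) ≠ pr lam.ord F (h α ξ) := by
    intro α
    by_cases hα : α < Λ
    · obtain ⟨α', h1, h2, h3⟩ := hcon α hα
      exact ⟨α', fun _ => ⟨h1, h2, by simpa [Filter.Frequently] using h3⟩⟩
    · exact ⟨0, fun h => absurd h hα⟩
  choose s hs using hs
  have hΛ0 : (0 : Ordinal.{u}) < Λ :=
    lt_of_lt_of_le (by simp) (ord_le_ord.2 (hinf.trans (Order.le_succ _)))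
  have hq : ∀ A : Set Ordinal.{u}, ∃ σ < Λ,
      (∃ σ' < Λ, ∀ᶠ ξ in atTop, ∀ α ∈ A, h α ξ < h σ' ξ) →
        ∀ᶠ ξ in atTop, ∀ α ∈ A, h α ξ < h σ ξ := by
    intro A
    by_cases hA : ∃ σ' < Λ, ∀ᶠ ξ in atTop, ∀ α ∈ A, h α ξ < h σ' ξ
    · obtain ⟨σ, h1, h2⟩ := hA
      exact ⟨σ, h1, fun _ => h2⟩
    · exact ⟨0, hΛ0, fun h => absurd h hA⟩
  choose q hq1 hq2 using hq
  obtain ⟨B, hB1, hB2⟩ := guess hθr hθ0 hμ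
  have hwf : ∃ ζ : Ordinal.{u} → Ordinal.{u}, ∀ i, ζ i = lsup {y | ∃ j, j < i ∧ y =
      max (s (ζ j)) (lsup {x | ∃ t, t < μ.ord ∧ x = q {w | ∃ k, k ≤ j ∧ k ∈ B t ∧ w = ζ k}})} := by
    let G : (i : Ordinal.{u}) → ((j : Ordinal.{u}) → j < i → Ordinal.{u}) → Ordinal.{u} :=
      fun i f => lsup {y | ∃ j, ∃ h : j < i, y =
        max (s (f j h)) (lsup {x | ∃ t, t < μ.ord ∧
          x = q {w | ∃ k, ∃ hk : k ≤ j, k ∈ B t ∧ w = f k (hk.trans_lt h)}})}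
    refine ⟨Ordinal.lt_wf.fix G, fun i => ?_⟩
    rw [WellFounded.fix_eq]
    simp only [G, exists_prop]
  obtain ⟨ζ, hζ⟩ := hwf
  let A : Ordinal.{u} → Ordinal.{u} → Set Ordinal.{u} :=
    fun t j => {w | ∃ k, k ≤ j ∧ k ∈ B t ∧ w = ζ k}
  let G : Ordinal.{u} → Ordinal.{u} := fun j =>
    max (s (ζ j)) (lsup {x | ∃ t, t < μ.ord ∧ x = q (A t j)})
  have hqb : ∀ j, ∀ x ∈ {x | ∃ t, t < μ.ord ∧ x = q (A t j)}, x < Λ := by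
    rintro j _ ⟨t, _, rfl⟩
    exact hq1 _
  have hGb : ∀ j, ζ j < Λ → G j < Λ := by
    intro j hj
    refine max_lt (hs _ hj).2.1 (lsup_lt hΛr ?_ (hqb j))
    have : {x | ∃ t, t < μ.ord ∧ x = q (A t j)} = (fun t => q (A t j)) '' Set.Iio μ.ord := by
      ext y; simp [eq_comm]
    rw [this]
    refine (mk_image_Iio_le _ _).trans_lt ?_
    rw [lift_lt, card_ord]
    exact hμΛ
  have hζ' : ∀ i, ζ i = lsup {y | ∃ j, j < i ∧ y = G j} := hζ
  have hz1 : ∀ i ≤ μ.ord, ζ i < Λ := by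
    intro i
    induction i using WellFoundedLT.induction with
    | ind i ih =>
      intro hi
      rw [hζ']
      apply lsup_lt hΛr
      · have : {y | ∃ j, j < i ∧ y = G j} = G '' Set.Iio i := by
          ext y; simp [eq_comm]
        rw [this]
        refine (mk_image_Iio_le _ _).trans_lt ?_
        rw [lift_lt]
        refine lt_of_le_of_lt (Ordinal.card_le_card hi) ?_
        rwa [card_ord]
      · rintro _ ⟨j, hj, rfl⟩
        exact hGb _ (ih j hj (hj.le.trans hi))
  have hz2 : ∀ i ≤ μ.ord, ∀ j < i, G j < ζ i := by
    intro i hi j hj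
    rw [hζ' i]
    refine lt_lsup (b := Λ) ?_ ⟨j, hj, rfl⟩
    rintro _ ⟨j, hj, rfl⟩
    exact hGb _ (hz1 j (hj.le.trans hi))
  have hsucc : ∀ j < μ.ord, j + 1 < μ.ord := fun j hj => reg_add_one_lt hμr.1 hj
  have hzm : ∀ i ≤ μ.ord, ∀ j < i, ζ j < ζ i := by
    intro i hi j hj
    exact ((hs _ (hz1 j (hj.le.trans hi))).1.trans (le_max_left _ _)).trans_lt (hz2 i hi j hj)
  have hz3 : ∀ i ≤ μ.ord, (∀ j < i, j + 1 < i) → ∀ y < ζ i, ∃ j < i, y < ζ j := by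
    intro i hi hlim y hy
    rw [hζ' i] at hy
    obtain ⟨_, ⟨j, hj, rfl⟩, hyj⟩ := exists_of_lt_lsup hy
    exact ⟨j + 1, hlim j hj,
      hyj.trans_lt (hz2 _ ((hlim j hj).le.trans hi) _ (lt_add_one j))⟩
  obtain ⟨g, hg1, hg2, hg3⟩ := clubOf_match hμr (δ := ζ μ.ord) ζ
    (fun i hi => hzm _ le_rfl i hi)
    (fun y hy => by
      obtain ⟨j, hj, hyj⟩ := hz3 _ le_rfl hsucc y hy
      exact ⟨j, hj, hyj.le⟩)
    (fun i hi j hj => hzm i hi.le j hj)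
    (fun i hi hl => hz3 i hi.le hl)
  obtain ⟨t, ht, hYcard, hYcl⟩ := hB2 g hg1
  set Y := B t with hY
  have hYμ : ∀ i ∈ Y, i < μ.ord := hB1 t
  have hdom : ∀ i ∈ Y, ∀ᶠ ξ in atTop, ∀ α ∈ A t i, h α ξ < h (q (A t i)) ξ := by
    intro i hi
    apply hq2
    refine ⟨ζ μ.ord, hz1 _ le_rfl, ?_⟩
    filter_upwards [hc _ (hz1 _ le_rfl)] with ξ hξ
    rintro _ ⟨k, hk, hkY, rfl⟩
    exact hξ _ (hg3 k (hYμ k hkY) (hYcl k hkY)) (hzm _ le_rfl k (hYμ k hkY))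
  let W : Ordinal.{u} → K → Ordinal.{u} := fun i ξ =>
    lsup {y | ∃ j, j ∈ Y ∧ j ≤ i ∧ y = h (ζ j) ξ}
  have hWb : ∀ i ξ, ∀ y ∈ {y | ∃ j, j ∈ Y ∧ j ≤ i ∧ y = h (ζ j) ξ}, y < lam.ord := by
    rintro i ξ _ ⟨j, hj, _, rfl⟩
    exact ha _ (hz1 j (hYμ j hj).le) ξ
  have hWle : ∀ i ξ, W i ξ ≤ lam.ord := fun i ξ => lsup_le (hWb i ξ)
  have hWmono : ∀ i i', i ≤ i' → ∀ ξ, W i ξ ≤ W i' ξ := by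
    intro i i' hii ξ
    apply lsup_le
    rintro _ ⟨j, hj, hji, rfl⟩
    exact lt_lsup (hWb i' ξ) ⟨j, hj, hji.trans hii, rfl⟩
  let Q : Ordinal.{u} → K → Ordinal.{u} := fun i ξ => pr lam.ord F (W i ξ)
  have hQmono : ∀ i i', i ≤ i' → ∀ ξ, Q i ξ ≤ Q i' ξ := fun i i' hii ξ =>
    pr_mono F (hWmono i i' hii ξ) (hWle i' ξ)
  have hstep : ∀ i ∈ Y, ∀ i' ∈ Y, i < i' → ∃ ξ, Q i ξ < Q i' ξ := by
    intro i hi i' hi' hii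
    have hi1 : i + 1 < i' := (hg2 i).trans_lt (hYcl i' hi' i hii)
    have hi'μ := hYμ i' hi'
    have hi1μ : i + 1 < μ.ord := hi1.trans hi'μ
    have haΛ := hz1 (i + 1) hi1μ.le
    obtain ⟨hs1, hs2, hs3⟩ := hs _ haΛ
    have e1 : ∀ᶠ ξ in atTop, h (q (A t i)) ξ < h (ζ (i + 1)) ξ := by
      apply hb _ haΛ
      refine lt_trans ?_ (hz2 _ hi1μ.le i (lt_add_one i))
      exact (lt_lsup (hqb i) ⟨t, ht, rfl⟩).trans_le (le_max_right _ _)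
    have e2 : ∀ᶠ ξ in atTop, h (ζ (i + 1)) ξ ≤ h (s (ζ (i + 1))) ξ := by
      rcases hs1.eq_or_lt with he | hlt
      · rw [← he]; exact Eventually.of_forall fun _ => le_rfl
      · exact (hb _ hs2 _ hlt).mono fun _ h => h.le
    have e3 : ∀ᶠ ξ in atTop, h (s (ζ (i + 1))) ξ < h (ζ i') ξ := by
      apply hb _ (hz1 i' hi'μ.le)
      exact (le_max_left _ _).trans_lt (hz2 i' hi'μ.le (i + 1) hi1)
    obtain ⟨ξ, hne, h0, h1, h2, h3⟩ :=
      (hs3.and_eventually ((hdom i hi).and (e1.and (e2.and e3)))).exists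
    refine ⟨ξ, ?_⟩
    have hWi : W i ξ ≤ h (ζ (i + 1)) ξ := by
      apply lsup_le
      rintro _ ⟨j, hj, hji, rfl⟩
      exact (h0 _ ⟨j, hji, hj, rfl⟩).trans h1
    have hWi' : h (s (ζ (i + 1))) ξ ≤ W i' ξ :=
      (h3.trans (lt_lsup (hWb i' ξ) ⟨i', hi', le_rfl, rfl⟩)).le
    calc Q i ξ ≤ pr lam.ord F (h (ζ (i + 1)) ξ) := pr_mono F hWi (ha _ haΛ ξ).le
      _ < pr lam.ord F (h (s (ζ (i + 1))) ξ) :=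
        lt_of_le_of_ne (pr_mono F h2 (ha _ hs2 ξ).le) (Ne.symm hne)
      _ ≤ Q i' ξ := pr_mono F hWi' (hWle _ _)
  have hpick : ∀ i : Y, ∃ ξ, ∀ i' ∈ Y, i.1 < i' → Q i.1 ξ < Q i' ξ := by
    rintro ⟨i, hi⟩
    by_cases hne : {j | j ∈ Y ∧ i < j}.Nonempty
    · have hmem := csInf_mem hne
      obtain ⟨ξ, hξ⟩ := hstep i hi _ hmem.1 hmem.2
      refine ⟨ξ, fun i' hi' hii => hξ.trans_le (hQmono _ _ ?_ ξ)⟩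
      exact csInf_le' ⟨hi', hii⟩
    · exact ⟨Classical.arbitrary K, fun i' hi' hii => absurd ⟨i', hi', hii⟩ hne⟩
  choose x hx using hpick
  have hinj : Function.Injective (fun i : Y =>
      ((x i, ⟨Q i.1 (x i), (pr_spec F (hWle i.1 (x i))).1⟩) :
        K × (insert lam.ord F : Set Ordinal.{u}))) := by
    intro i j hij
    simp only [Prod.mk.injEq, Subtype.mk.injEq] at hij
    obtain ⟨h1, h2⟩ := hij
    rcases lt_trichotomy i.1 j.1 with h3 | h3 | h3
    · have := hx i j.1 j.2 h3
      rw [h2, h1] at this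
      exact absurd this (lt_irrefl _)
    · exact Subtype.ext h3
    · have := hx j i.1 i.2 h3
      rw [← h2, h1] at this
      exact absurd this (lt_irrefl _)
  have hle := mk_le_of_injective hinj
  have hν' : ℵ₀ ≤ lift.{u + 1} ν := by rwa [aleph0_le_lift]
  have hins : #(insert lam.ord F : Set Ordinal.{u}) ≤ lift.{u + 1} ν :=
    mk_insert_le.trans ((add_le_add_left hF 1).trans (add_one_eq hν').le)
  rw [mk_prod, lift_id'.{u, u + 1}] at hle
  have h6 := hYcard.trans (hle.trans (mul_le_mul' (Cardinal.lift_le.2 hK) hins))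
  rw [mul_eq_self hν', Cardinal.lift_le] at h6
  exact (Order.lt_succ ν).not_ge h6

open Filter in
/-- `D` makes the linear order `T` unbounded. -/
def UnbT {I : Type u} (D : Ultrafilter I) (T : Type u) [LinearOrder T] : Prop :=
  ∃ g : I → T, ∀ ξ, ∀ᶠ i in (D : Filter I), ξ ≤ g i

/-- The ordinal corresponding to a point of `o.ToType`. -/
noncomputable def toO {o : Ordinal.{u}} (x : o.ToType) : Ordinal.{u} :=
  (Ordinal.ToType.mk.symm x).1

theorem toO_lt {o : Ordinal.{u}} (x : o.ToType) : toO x < o := (Ordinal.ToType.mk.symm x).2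

theorem toO_mk {o a : Ordinal.{u}} (h : a < o) : toO (Ordinal.ToType.mk ⟨a, h⟩) = a := by
  simp [toO]

theorem toO_le {o : Ordinal.{u}} {x y : o.ToType} : toO x ≤ toO y ↔ x ≤ y := by
  simp only [toO, Subtype.coe_le_coe, OrderIso.le_iff_le]

theorem toO_lt_iff {o : Ordinal.{u}} {x y : o.ToType} : toO x < toO y ↔ x < y := by
  simp only [toO, Subtype.coe_lt_coe, OrderIso.lt_iff_lt]

theorem toO_inj {o : Ordinal.{u}} : Function.Injective (toO : o.ToType → Ordinal.{u}) :=
  fun _ _ h => le_antisymm (toO_le.1 h.le) (toO_le.1 h.ge)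

theorem mk_Iic_lt {c : Cardinal.{u}} (hc : ℵ₀ ≤ c) (x : c.ord.ToType) : #(Set.Iic x) < c := by
  have h1 := reg_add_one_lt hc (toO_lt x)
  refine (mk_le_mk_of_subset (t := Set.Iio (Ordinal.ToType.mk ⟨toO x + 1, h1⟩)) ?_).trans_lt
    (mk_Iio_toType_ord_lt _)
  intro y hy
  have hy' : y ≤ x := hy
  rw [Set.mem_Iio, ← toO_lt_iff, toO_mk]
  exact (toO_le.2 hy').trans_lt (lt_add_one _)

theorem mk_toO_image {o : Ordinal.{u}} (s : Set o.ToType) : #(toO '' s) = lift.{u + 1} #s := by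
  have := mk_image_eq_lift toO s toO_inj
  rw [lift_id'.{u, u + 1}] at this
  simpa using this

theorem regU_iff {c : Cardinal.{u}} (hc : c.IsRegular) {I : Type u} (D : Ultrafilter I) :
    RegU D c c.ord.ToType ↔ UnbT D c.ord.ToType := by
  constructor
  · rintro ⟨f, hf1, hf2⟩
    have hb : ∀ i, ∀ x ∈ toO '' f i, x < c.ord := by
      rintro i _ ⟨x, _, rfl⟩
      exact toO_lt x
    have hlt : ∀ i, lsup (toO '' f i) < c.ord := by
      intro i
      apply lsup_lt hc _ (hb i)
      rw [mk_toO_image, lift_lt]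
      exact hf1 i
    refine ⟨fun i => Ordinal.ToType.mk ⟨_, hlt i⟩, fun ξ => (hf2 ξ).mono fun i hi => ?_⟩
    rw [← toO_le, toO_mk]
    exact (lt_lsup (hb i) ⟨ξ, hi, rfl⟩).le
  · rintro ⟨g, hg⟩
    exact ⟨fun i => Set.Iic (g i), fun i => mk_Iic_lt hc.1 _, fun a => hg a⟩

theorem exists_l {lam : Cardinal.{u}} (hinf : ℵ₀ ≤ lam) (hsing : lam.ord.cof < lam) :
    ∃ l : lam.ord.cof.ord.ToType → Cardinal.{u}, Monotone l ∧ (∀ ξ, ℵ₀ ≤ l ξ) ∧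
      (∀ ξ, l ξ < lam) ∧ (∀ c < lam, ∃ ξ, c < l ξ) := by
  have hκ : ℵ₀ ≤ lam.ord.cof := Ordinal.aleph0_le_cof.2 (isSuccLimit_ord hinf)
  have hlim : ∀ c < lam, Order.succ c < lam := by
    intro c hc
    refine lt_of_le_of_ne (Order.succ_le_of_lt hc) ?_
    rintro rfl
    by_cases h : ℵ₀ ≤ c
    · exact hsing.ne (isRegular_succ h).cof_ord
    · have h1 : c < ℵ₀ := not_le.1 h
      exact absurd hinf (not_le.2 (isSuccLimit_aleph0.succ_lt h1))
  obtain ⟨s, hs1, hs2⟩ := Order.exists_cof_eq lam.ord.ToType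
  rw [Ordinal.cof_toType] at hs2
  have h1 : #(lam.ord.cof.ord.ToType) = #s := by rw [hs2, mk_toType, card_ord]
  obtain ⟨eq⟩ := Cardinal.eq.1 h1
  let c : lam.ord.cof.ord.ToType → Cardinal.{u} := fun η => Order.succ (toO (eq η).1).card
  have hc : ∀ η, c η < lam := fun η => hlim _ (lt_ord.1 (toO_lt _))
  have hbdd : ∀ ξ, BddAbove (Set.range fun η : Set.Iic ξ => c η.1) := fun ξ =>
    bddAbove_range _
  refine ⟨fun ξ => max ℵ₀ (⨆ η : Set.Iic ξ, c η.1), ?_, fun ξ => le_max_left _ _, ?_, ?_⟩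
  · intro ξ ξ' h
    refine max_le_max le_rfl ?_
    refine ciSup_le' fun η => ?_
    exact le_ciSup (hbdd ξ') ⟨η.1, le_trans η.2 h⟩
  · intro ξ
    refine max_lt (hκ.trans_lt hsing) ?_
    exact iSup_lt_of_lt_cof_ord (mk_Iic_lt hκ ξ) fun η => hc _
  · intro d hd
    obtain ⟨x, hx, hdx⟩ := hs1 (Ordinal.ToType.mk ⟨d.ord, ord_lt_ord.2 hd⟩)
    refine ⟨eq.symm ⟨x, hx⟩, lt_of_lt_of_le ?_ ((le_ciSup (hbdd _) ⟨eq.symm ⟨x, hx⟩, Set.mem_Iic.2 le_rfl⟩).trans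
      (le_max_right _ _))⟩
    simp only [c, Equiv.apply_symm_apply]
    rw [Order.lt_succ_iff, ← ord_le, ← toO_mk (ord_lt_ord.2 hd), toO_le]
    exact hdx

open Filter in
theorem cc_lemma {I : Type u} {D : Ultrafilter I} {K : Type u} [LinearOrder K] [Nonempty K]
    (hK : ¬ UnbT D K) {p : I → K → Prop} (hp : ∀ᶠ i in (D : Filter I), ∀ᶠ ξ in atTop, p i ξ) :
    ∃ ξ₀, ∀ᶠ i in (D : Filter I), ∀ ξ, ξ₀ ≤ ξ → p i ξ := by
  have h1 : ∀ i, ∃ ξ₀, (∀ᶠ ξ in atTop, p i ξ) → ∀ ξ, ξ₀ ≤ ξ → p i ξ := by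
    intro i
    by_cases h : ∀ᶠ ξ in atTop, p i ξ
    · obtain ⟨ξ₀, h0⟩ := eventually_atTop.1 h
      exact ⟨ξ₀, fun _ => h0⟩
    · exact ⟨Classical.arbitrary K, fun h' => absurd h' h⟩
  choose g hg using h1
  unfold UnbT at hK
  push Not at hK
  obtain ⟨ξ₀, h0⟩ := hK g
  refine ⟨ξ₀, ?_⟩
  filter_upwards [h0, hp] with i hi hpi ξ hξ
  exact hg i hpi ξ (hi.le.trans hξ)

theorem reg_of_unbK {lam : Cardinal.{u}} {I : Type u} {D : Ultrafilter I} {K : Type u}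
    [LinearOrder K] (l : K → Cardinal.{u}) (hmono : Monotone l) (hl1 : ∀ ξ, l ξ < lam)
    (hl2 : ∀ c < lam, ∃ ξ, c < l ξ) (h : UnbT D K) : RegU D lam lam.ord.ToType := by
  obtain ⟨g, hg⟩ := h
  refine ⟨fun i => Set.Iio (Ordinal.ToType.mk ⟨(l (g i)).ord, ord_lt_ord.2 (hl1 _)⟩),
    fun i => mk_Iio_toType_ord_lt _, fun a => ?_⟩
  obtain ⟨ξ, hξ⟩ := hl2 _ (lt_ord.1 (toO_lt a))
  refine (hg ξ).mono fun i hi => ?_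
  rw [Set.mem_Iio, ← toO_lt_iff, toO_mk]
  exact lt_ord.2 (hξ.trans_le (hmono hi))

open Filter in
theorem fwd {lam : Cardinal.{u}} (hinf : ℵ₀ ≤ lam) {I : Type u} {D : Ultrafilter I} {K : Type u}
    [LinearOrder K] [Nonempty K] (hKc : #K < lam) (hlim : ∀ c < lam, Order.succ c < lam)
    (l : K → Cardinal.{u}) (hmono : Monotone l) (hl0 : ∀ ξ, ℵ₀ ≤ l ξ) (hl1 : ∀ ξ, l ξ < lam)
    (hl2 : ∀ c < lam, ∃ ξ, c < l ξ) (hK : ¬ UnbT D K)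
    (hr : RegU D lam lam.ord.ToType) : UnbT D (Order.succ lam).ord.ToType := by
  classical
  obtain ⟨f, hf1, hf2⟩ := hr
  obtain ⟨ξ₀, h0⟩ := cc_lemma hK (p := fun i ξ => #(f i) ≤ l ξ)
    (Eventually.of_forall fun i => by
      obtain ⟨ξ, hξ⟩ := hl2 _ (hf1 i)
      filter_upwards [eventually_ge_atTop ξ] with η hη
      exact hξ.le.trans (hmono hη))
  have h0' : ∀ᶠ i in (D : Filter I), #(f i) ≤ l ξ₀ := h0.mono fun i hi => hi ξ₀ le_rfl
  obtain ⟨ν, hνdef⟩ : ∃ ν, ν = max (l ξ₀) #K := ⟨_, rfl⟩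
  have hν0 : ℵ₀ ≤ ν := hνdef ▸ (hl0 ξ₀).trans (le_max_left _ _)
  have hνK : #K ≤ ν := hνdef ▸ le_max_right _ _
  have hνl : l ξ₀ ≤ ν := hνdef ▸ le_max_left _ _
  have hν : ν < lam := hνdef ▸ max_lt (hl1 _) hKc
  obtain ⟨μ, hμ⟩ : ∃ μ, μ = Order.succ (Order.succ (Order.succ ν)) := ⟨_, rfl⟩
  have hμl : μ < lam := hμ ▸ hlim _ (hlim _ (hlim _ hν))
  obtain ⟨h, ha, hb, hc⟩ := exists_h l hmono hl0 hl1 hlim hl2 hμl (clubOf μ.ord) (mk_clubOf μ)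
  let F : I → Set Ordinal.{u} := fun i => if #(f i) ≤ ν then toO '' f i else ∅
  have hF : ∀ i, #(F i) ≤ Cardinal.lift.{u + 1} ν := by
    intro i
    by_cases hi : #(f i) ≤ ν
    · simp only [F, if_pos hi]
      rw [mk_toO_image]
      exact Cardinal.lift_le.2 hi
    · simp only [F, if_neg hi]
      simp
  have hst := fun i => stab hν0 hνK hμ hμl h ha hb hc (F i) (hF i)
  choose α hα1 hα2 using hst
  by_contra hcon
  unfold UnbT at hcon
  push Not at hcon
  obtain ⟨β, hβ⟩ := hcon (fun i => Ordinal.ToType.mk ⟨α i, hα1 i⟩)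
  have hαβ : ∀ᶠ i in (D : Filter I), α i < toO β := by
    refine hβ.mono fun i hi => ?_
    rw [← toO_lt_iff, toO_mk] at hi
    exact hi
  have hbΛ := toO_lt β
  have hb1Λ : toO β + 1 < (Order.succ lam).ord :=
    reg_add_one_lt (hinf.trans (Order.le_succ _)) hbΛ
  obtain ⟨ξ₁, h1⟩ := cc_lemma hK (p := fun i ξ =>
      pr lam.ord (F i) (h (toO β) ξ) = pr lam.ord (F i) (h (toO β + 1) ξ))
    (hαβ.mono fun i hi => by
      filter_upwards [hα2 i _ hi.le hbΛ, hα2 i _ (hi.le.trans (lt_add_one _).le) hb1Λ]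
        with ξ e1 e2
      rw [e1, e2])
  obtain ⟨ξ, hξ1, hξ2⟩ := ((eventually_ge_atTop ξ₁).and (hb _ hb1Λ _ (lt_add_one _))).exists
  obtain ⟨i, hi0, hi1, hi2⟩ := (h0'.and (h1.and
    (hf2 (Ordinal.ToType.mk ⟨h (toO β) ξ, ha _ hbΛ ξ⟩)))).exists
  have hmem : h (toO β) ξ ∈ F i := by
    simp only [F, if_pos (hi0.trans hνl)]
    exact ⟨_, hi2, toO_mk _⟩
  have h5 := hi1 ξ hξ1
  rw [pr_eq hmem (ha _ hbΛ ξ).le] at h5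
  have h6 := (pr_spec (F i) (ha _ hb1Λ ξ).le).2
  rw [← h5] at h6
  exact absurd hξ2 h6.not_gt

open Filter in
theorem bwd {lam : Cardinal.{u}} (hinf : ℵ₀ ≤ lam) {I : Type u} {D : Ultrafilter I} {K : Type u}
    [LinearOrder K] [Nonempty K] (hKc : #K < lam)
    (l : K → Cardinal.{u}) (hmono : Monotone l) (hl1 : ∀ ξ, l ξ < lam)
    (hl2 : ∀ c < lam, ∃ ξ, c < l ξ) (hK : ¬ UnbT D K)
    (hu : UnbT D (Order.succ lam).ord.ToType) : RegU D lam lam.ord.ToType := by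
  obtain ⟨g, hg⟩ := hu
  have hs : ℵ₀ ≤ Order.succ lam := hinf.trans (Order.le_succ _)
  have he := fun i => exists_e (reg_add_one_lt hs (toO_lt (g i)))
  choose e he1 he2 using he
  have hξ : ∀ a : (Order.succ lam).ord.ToType, ∃ ξ, ∀ᶠ i in (D : Filter I),
      toO a < toO (g i) + 1 ∧ e i (toO a) < (l ξ).ord := by
    intro a
    have h1 : ∀ᶠ i in (D : Filter I), toO a < toO (g i) + 1 :=
      (hg a).mono fun i hi => (toO_le.2 hi).trans_lt (lt_add_one _)
    obtain ⟨ξ, h2⟩ := cc_lemma hK (p := fun i ξ => e i (toO a) < (l ξ).ord)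
      (h1.mono fun i hi => by
        obtain ⟨ξ, hξ⟩ := hl2 _ (lt_ord.1 (he2 i _ hi))
        filter_upwards [eventually_ge_atTop ξ] with η hη
        exact lt_ord.2 (hξ.trans_le (hmono hη)))
    exact ⟨ξ, h1.and (h2.mono fun i hi => hi ξ le_rfl)⟩
  choose x hx using hξ
  obtain ⟨ξ, hZ⟩ := infinite_pigeonhole_card x (Order.succ lam)
    (by rw [mk_toType, card_ord]) hs
    (by rw [(isRegular_succ hinf).cof_ord]; exact hKc.trans (Order.lt_succ _))
  have hreg : RegU D lam (x ⁻¹' {ξ}) := by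
    refine ⟨fun i => {z | toO z.1 < toO (g i) + 1 ∧ e i (toO z.1) < (l ξ).ord}, fun i => ?_, ?_⟩
    · refine lt_of_le_of_lt ?_ (hl1 ξ)
      rw [← Cardinal.lift_le.{u + 1}]
      refine le_trans ?_ (mk_e_lt (he1 i) (l ξ))
      have hinj : Function.Injective (fun z : {z : x ⁻¹' {ξ} |
          toO z.1 < toO (g i) + 1 ∧ e i (toO z.1) < (l ξ).ord} =>
          (⟨toO z.1.1, z.2⟩ : {β : Ordinal.{u} | β < toO (g i) + 1 ∧ e i β < (l ξ).ord})) := by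
        intro y z h
        exact Subtype.ext (Subtype.ext (toO_inj (Subtype.mk.inj h)))
      have := lift_mk_le_lift_mk_of_injective hinj
      rwa [lift_id'.{u, u + 1}] at this
    · rintro ⟨a, ha⟩
      have ha' : x a = ξ := ha
      have := hx a
      rw [ha'] at this
      exact this
  refine hreg.of_le ?_
  rw [mk_toType, card_ord]
  exact (Order.le_succ lam).trans hZ

/-- Corollary: if `λ` is singular, then a family of topological spaces is
productively `[λ, λ]`-compact if and only if it is either productively
`[cf λ, cf λ]`-compact or productively `[λ⁺, λ⁺]`-compact. -/
theorem productively_compact_iff {ι : Type u} (𝓕 : ι → Type u)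
    [∀ i, TopologicalSpace (𝓕 i)] (lam : Cardinal.{u})
    (hinf : ℵ₀ ≤ lam) (hsing : lam.ord.cof < lam) :
    IsProductivelyMuLamCompact 𝓕 lam lam ↔
      (IsProductivelyMuLamCompact 𝓕 lam.ord.cof lam.ord.cof ∨
        IsProductivelyMuLamCompact 𝓕 (Order.succ lam) (Order.succ lam)) := by
  have hκ0 : ℵ₀ ≤ lam.ord.cof := Ordinal.aleph0_le_cof.2 (isSuccLimit_ord hinf)
  have hκr : lam.ord.cof.IsRegular := isRegular_cof (isSuccLimit_ord hinf)
  have hΛr : (Order.succ lam).IsRegular := isRegular_succ hinf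
  have hlim : ∀ c < lam, Order.succ c < lam := by
    intro c hc
    refine lt_of_le_of_ne (Order.succ_le_of_lt hc) ?_
    rintro rfl
    by_cases h : ℵ₀ ≤ c
    · exact hsing.ne (isRegular_succ h).cof_ord
    · have h1 : c < ℵ₀ := not_le.1 h
      exact absurd hinf (not_le.2 (isSuccLimit_aleph0.succ_lt h1))
  obtain ⟨l, hmono, hl0, hl1, hl2⟩ := exists_l hinf hsing
  have hcK : #(lam.ord.cof.ord.ToType) = lam.ord.cof := by rw [mk_toType, card_ord]
  have hcL : #(lam.ord.ToType) = lam := by rw [mk_toType, card_ord]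
  have hcP : #((Order.succ lam).ord.ToType) = Order.succ lam := by rw [mk_toType, card_ord]
  have iK : Infinite lam.ord.cof.ord.ToType := infinite_iff.2 (by rw [hcK]; exact hκ0)
  have iL : Infinite lam.ord.ToType := infinite_iff.2 (by rw [hcL]; exact hinf)
  have iP : Infinite (Order.succ lam).ord.ToType := infinite_iff.2 (by rw [hcP]; exact hΛr.1)
  have hKc : #(lam.ord.cof.ord.ToType) < lam := hcK.trans_lt hsing
  constructor
  · intro h
    obtain ⟨I, D, hr, hD⟩ := reg_of_pc 𝓕 hinf hcL h
    by_cases hu : UnbT D lam.ord.cof.ord.ToType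
    · exact Or.inl (pc_of_reg 𝓕 hcK ((regU_iff hκr D).2 hu) hD)
    · exact Or.inr (pc_of_reg 𝓕 hcP ((regU_iff hΛr D).2
        (fwd hinf hKc hlim l hmono hl0 hl1 hl2 hu hr)) hD)
  · rintro (h | h)
    · obtain ⟨I, D, hr, hD⟩ := reg_of_pc 𝓕 hκ0 hcK h
      exact pc_of_reg 𝓕 hcL (reg_of_unbK l hmono hl1 hl2 ((regU_iff hκr D).1 hr)) hD
    · obtain ⟨I, D, hr, hD⟩ := reg_of_pc 𝓕 hΛr.1 hcP h
      refine pc_of_reg 𝓕 hcL ?_ hD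
      by_cases hu : UnbT D lam.ord.cof.ord.ToType
      · exact reg_of_unbK l hmono hl1 hl2 hu
      · exact bwd hinf hKc l hmono hl1 hl2 hu ((regU_iff hΛr D).1 hr)
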